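/- Let y ∈ S_n be 312-avoiding, and let x ∈ S_n be 312-avoiding and sylvester-congruent to Pop(y). Then x_n = n, i.e., the last entry of x equals n. -/

import Mathlib

/-- `w` is (the word of) a permutation of `{1, …, n}`. -/
def IsPermWord (n : ℕ) (w : List ℕ) : Prop := w.Perm (List.range' 1 n)

/-- `w` is 312-avoiding: there are no positions `i < j < k` with `w_j < w_k < w_i`. -/
def Avoids312 (w : List ℕ) : Prop :=
  ¬ ∃ i j k : ℕ, i < j ∧ j < k ∧ k < w.length ∧
      w.getD j 0 < w.getD k 0 ∧ w.getD k 0 < w.getD i 0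

/-- `w` is 231-avoiding: there are no positions `i < j < k` with `w_k < w_i < w_j`. -/
def Avoids231 (w : List ℕ) : Prop :=
  ¬ ∃ i j k : ℕ, i < j ∧ j < k ∧ k < w.length ∧
      w.getD k 0 < w.getD i 0 ∧ w.getD i 0 < w.getD j 0

/-- `w` has a double descent: three consecutive strictly decreasing entries. -/
def HasDoubleDescent (w : List ℕ) : Prop :=
  ∃ i : ℕ, i + 2 < w.length ∧
    w.getD (i + 1) 0 < w.getD i 0 ∧ w.getD (i + 2) 0 < w.getD (i + 1) 0

/-- Length of the maximal strictly decreasing run at the start of a word. -/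
def decRunLen : List ℕ → ℕ
  | [] => 0
  | [_] => 1
  | a :: b :: rest => if b < a then decRunLen (b :: rest) + 1 else 1

lemma one_le_decRunLen (a : ℕ) (t : List ℕ) : 1 ≤ decRunLen (a :: t) := by
  cases t <;> simp [decRunLen] <;> split <;> omega

/-- The pop-stack-sorting map on words: reverse every maximal descending run. -/
def popWord (w : List ℕ) : List ℕ :=
  match w with
  | [] => []
  | a :: t =>
      ((a :: t).take (decRunLen (a :: t))).reverse ++
        popWord ((a :: t).drop (decRunLen (a :: t)))
termination_by w.length
decreasing_by
  have := one_le_decRunLen a t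
  simp [List.length_drop]
  omega

/-- Two words are sylvester-adjacent if one is `X a c Y b Z` and the other is
`X c a Y b Z` for letters `a < b < c`. -/
def SylvAdj (u v : List ℕ) : Prop :=
  ∃ (X Y Z : List ℕ) (a b c : ℕ), a < b ∧ b < c ∧
    u = X ++ a :: c :: (Y ++ b :: Z) ∧ v = X ++ c :: a :: (Y ++ b :: Z)

/-- The sylvester congruence: the reflexive-symmetric-transitive closure of
sylvester-adjacency. -/
def SylvCongr : List ℕ → List ℕ → Prop := Relation.EqvGen SylvAdj

/-- A 312-avoiding word has no subsequence `c, a, b` with `a < b < c`. -/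
lemma Avoids312.not_sublist {w : List ℕ} (h : Avoids312 w) {a b c : ℕ} (hab : a < b)
    (hbc : b < c) : ¬ [c, a, b].Sublist w := by
  intro hs
  obtain ⟨f, hf⟩ := List.sublist_iff_exists_fin_orderEmbedding_get_eq.1 hs
  have h0 := hf ⟨0, by simp⟩
  have h1 := hf ⟨1, by simp⟩
  have h2 := hf ⟨2, by simp⟩
  simp only [List.get_eq_getElem, List.getElem_cons_zero, List.getElem_cons_succ] at h0 h1 h2
  refine h ⟨f ⟨0, by simp⟩, f ⟨1, by simp⟩, f ⟨2, by simp⟩, f.strictMono (by simp),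
    f.strictMono (by simp), Fin.is_lt _, ?_⟩
  simp only [List.getD_eq_getElem _ _ (Fin.is_lt _), ← h0, ← h1, ← h2]
  exact ⟨hab, hbc⟩

/-- The first descending run of a nonempty word is bounded by its head, and its last letter does
not exceed the letter that follows it. -/
lemma exists_take_decRunLen_eq (a : ℕ) (t : List ℕ) :
    ∃ q p, (a :: t).take (decRunLen (a :: t)) = q ++ [p] ∧
      (∀ m ∈ (a :: t).take (decRunLen (a :: t)), m ≤ a) ∧
      ∀ r s, (a :: t).drop (decRunLen (a :: t)) = r :: s → p ≤ r := by
  induction t generalizing a with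
  | nil => exact ⟨[], a, by simp [decRunLen]⟩
  | cons b t ih =>
    by_cases hba : b < a
    · obtain ⟨q, p, h1, h2, h3⟩ := ih b
      refine ⟨a :: q, p, ?_, ?_, ?_⟩
      · simp [decRunLen, hba, h1]
      · simp only [decRunLen, hba, if_true, List.take_succ_cons, List.mem_cons]
        rintro m (rfl | hm)
        · exact le_rfl
        · exact (h2 m hm).trans hba.le
      · simpa [decRunLen, hba] using h3
    · refine ⟨[], a, ?_, ?_, ?_⟩ <;> simp [decRunLen, hba]
      omega

lemma popWord_cons (a : ℕ) (t : List ℕ) :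
    popWord (a :: t) = ((a :: t).take (decRunLen (a :: t))).reverse ++
      popWord ((a :: t).drop (decRunLen (a :: t))) := by
  rw [popWord]

lemma popWord_nil : popWord [] = [] := by
  rw [popWord]

/-- The image of a nonempty 312-avoiding word under the pop-stack-sorting map ends with the
maximum of the word. -/
lemma exists_getLast?_popWord (w : List ℕ) (hne : w ≠ []) (hnd : w.Nodup)
    (hav : ∀ a b c, a < b → b < c → ¬ [c, a, b].Sublist w) :
    ∃ M ∈ w, (popWord w).getLast? = some M ∧ ∀ m ∈ w, m ≤ M := by
  induction hl : w.length using Nat.strong_induction_on generalizing w with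
  | _ l ih =>
  obtain _ | ⟨a, t⟩ := w
  · exact absurd rfl hne
  obtain ⟨q, p, h1, h2, h3⟩ := exists_take_decRunLen_eq a t
  have hpos := one_le_decRunLen a t
  rw [popWord_cons]
  generalize decRunLen (a :: t) = k at *
  have hw : (a :: t).take k ++ (a :: t).drop k = a :: t := List.take_append_drop k _
  have hhead : ((a :: t).take k).head? = some a := by
    obtain _ | k := k
    · omega
    · simp
  rcases hd : (a :: t).drop k with _ | ⟨r, s⟩
  · rw [hd, List.append_nil] at hw
    refine ⟨a, by simp, ?_, fun m hm => h2 m (by rwa [hw])⟩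
    rw [popWord_nil, List.append_nil, List.getLast?_reverse, hhead]
  · have hlt : ((a :: t).drop k).length < l := by
      rw [← hl, List.length_drop, List.length_cons]; omega
    obtain ⟨M, hM, hlast, hmax⟩ := ih _ hlt _ (by simp [hd])
      (hnd.sublist (List.drop_sublist _ _))
      (fun a b c hab hbc hs => hav a b c hab hbc (hs.trans (List.drop_sublist _ _))) rfl
    have haM : a ≤ M := by
      have hrM : r ≤ M := hmax r (by simp [hd])
      have hpr : p ≤ r := h3 r s hd
      by_contra! hMa
      rw [h1] at hhead hw
      rw [hd] at hw
      obtain _ | ⟨a', q⟩ := q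
      · have : p = a := by simpa using hhead
        omega
      · have ha : a' = a := by simpa using hhead
        subst ha
        have hpr' : p ≠ r := by
          rintro rfl
          rw [← hw] at hnd
          simp [List.nodup_append] at hnd
        refine hav p r a' (by omega) (by omega) ?_
        rw [← hw]
        simp
    refine ⟨M, List.mem_of_mem_drop hM, by simp [← hd, List.getLast?_append, hlast], fun m hm => ?_⟩
    rw [← hw, List.mem_append] at hm
    exact hm.elim (fun h => (h2 m h).trans haM) (hmax m)

/-- Sylvester-congruent words have the same last letter. -/
lemma SylvCongr.getLast?_eq {u v : List ℕ} (h : SylvCongr u v) : u.getLast? = v.getLast? := by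
  induction h with
  | rel u v h =>
    obtain ⟨X, Y, Z, a, b, c, -, -, rfl, rfl⟩ := h
    simp [List.getLast?_append, List.getLast?_cons]
  | refl => rfl
  | symm _ _ _ ih => exact ih.symm
  | trans _ _ _ _ _ ih₁ ih₂ => exact ih₁.trans ih₂

/-- **Theorem (Statement 10).** If `y ∈ S_n` is 312-avoiding and `x ∈ S_n` is
312-avoiding and sylvester-congruent to `Pop(y)`, then the last entry of `x` is `n`. -/
theorem pop_image_last_entry (n : ℕ) (hn : 1 ≤ n) (y x : List ℕ)
    (hy : IsPermWord n y) (hy312 : Avoids312 y)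
    (hx : IsPermWord n x) (hx312 : Avoids312 x)
    (hcong : SylvCongr x (popWord y)) :
    x.getD (n - 1) 0 = n := by
  have hmem : ∀ m, m ∈ y ↔ 1 ≤ m ∧ m < 1 + n := fun m => by
    rw [hy.mem_iff, List.mem_range'_1]
  have hny : n ∈ y := (hmem n).2 (by omega)
  obtain ⟨M, hM, hlast, hmax⟩ := exists_getLast?_popWord y (List.ne_nil_of_mem hny)
    (hy.nodup_iff.2 List.nodup_range') (fun _ _ _ hab hbc => hy312.not_sublist hab hbc)
  have hMn : M = n := by
    have := (hmem M).1 hM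
    have := hmax n hny
    omega
  have hlen : x.length = n := by simpa using hx.length_eq
  have hx_last := hcong.getLast?_eq.trans hlast
  rw [List.getLast?_eq_getElem?, hlen] at hx_last
  rw [List.getD_eq_getElem?_getD, hx_last, hMn, Option.getD_some]
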